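/- Let L_n → ∞ and N_n ∈ ℕ with N_n/L_n^d → ρ, where ρ > ρ_c. Write z₀ = z₀(L_n, N_n) and p₀ = z₀/(1 − z₀). Then ( Π_{k ∈ ℤ^d ∖ {0}} (1 − z₀ g_k^{(L_n)}) / (1 − g_k^{(L_n)}) ) · exp( −((1 − z₀)/z₀)(N_n − p₀) ) → 1 as n → ∞. (Both infinite products converge since Σ_k g_k^{(L)} < ∞.) -/

import Mathlib

open MeasureTheory Filter

noncomputable section

/-- the eigenvalue `g_k^{(L)} = exp(-β|2πk/L|²)` of the periodic heat operator. -/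
def gk (d : ℕ) (β L : ℝ) (k : Fin d → ℤ) : ℝ :=
  Real.exp (-β * ∑ i, (2 * Real.pi * (k i : ℝ) / L) ^ 2)

/-- `a₁(p;1) = e^{-β|p|²}/(1 - e^{-β|p|²})`; `ρ_c = ∫ a₁(p;1) dp/(2π)^d`. -/
def a1crit (d : ℕ) (β : ℝ) (p : EuclideanSpace ℝ (Fin d)) : ℝ :=
  Real.exp (-β * ‖p‖ ^ 2) / (1 - Real.exp (-β * ‖p‖ ^ 2))

/-- Bose occupation function. -/
def bose (β s : ℝ) : ℝ := Real.exp (-β * s) / (1 - Real.exp (-β * s))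

lemma bose_zero (β : ℝ) : bose β 0 = 0 := by simp [bose]

lemma exp_sub_lt_one {t : ℝ} (ht : 0 < t) : 0 < 1 - Real.exp (-t) := by
  have : Real.exp (-t) < 1 := by simpa using ht
  linarith

lemma bose_nonneg {β s : ℝ} (hβ : 0 < β) (hs : 0 ≤ s) : 0 ≤ bose β s := by
  unfold bose
  have : Real.exp (-β * s) ≤ 1 := Real.exp_le_one_iff.2 (by nlinarith)
  exact div_nonneg (Real.exp_pos _).le (by linarith)

lemma bose_mono {β β' s s' : ℝ} (hpos : 0 < β' * s') (h : β' * s' ≤ β * s) :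
    bose β s ≤ bose β' s' := by
  unfold bose
  have h1 : Real.exp (-β * s) ≤ Real.exp (-β' * s') := Real.exp_le_exp.2 (by linarith)
  have h2 : 0 < 1 - Real.exp (-β' * s') := by
    have := exp_sub_lt_one hpos
    rwa [← neg_mul] at this
  exact div_le_div₀ (Real.exp_pos _).le h1 h2 (by linarith)

lemma exp_div_le {t : ℝ} (ht : 0 < t) :
    Real.exp (-t) / (1 - Real.exp (-t)) ≤ Real.exp (-(t/2)) / t := by
  have h1 : t / 2 ≤ Real.sinh (t/2) := Real.self_le_sinh_iff.2 (by linarith)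
  rw [Real.sinh_eq] at h1
  have h2 : Real.exp (-t) = Real.exp (-(t/2)) * Real.exp (-(t/2)) := by
    rw [← Real.exp_add]; ring_nf
  have h3 : Real.exp (t/2) * Real.exp (-(t/2)) = 1 := by
    rw [← Real.exp_add]; simp
  have h4 := Real.exp_pos (-(t/2))
  rw [div_le_div_iff₀ (exp_sub_lt_one ht) ht]
  rw [h2]
  nlinarith [mul_le_mul_of_nonneg_left h1 (mul_pos h4 h4).le]

lemma bose_le {β s : ℝ} (h : 0 < β * s) :
    bose β s ≤ Real.exp (-(β * s / 2)) / (β * s) := by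
  have := exp_div_le h
  simpa [bose] using this

lemma bose_le_inv {β s : ℝ} (h : 0 < β * s) : bose β s ≤ 1 / (β * s) := by
  refine (bose_le h).trans ?_
  gcongr
  exact Real.exp_le_one_iff.2 (by linarith)

lemma measurable_bose (β : ℝ) : Measurable (bose β) := by
  unfold bose; fun_prop

lemma bose_continuousAt {β s : ℝ} (h : 0 < β * s) : ContinuousAt (bose β) s := by
  unfold bose
  apply ContinuousAt.div
  · fun_prop
  · fun_prop
  · have := exp_sub_lt_one h
    rw [← neg_mul] at this
    exact this.ne'

lemma integrable_bose_norm (d : ℕ) (hd : 2 < d) (β : ℝ) (hβ : 0 < β) :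
    Integrable (fun p : EuclideanSpace ℝ (Fin d) => bose β (‖p‖ ^ 2)) := by
  have : Nonempty (Fin d) := ⟨⟨0, by omega⟩⟩
  have : Nontrivial (EuclideanSpace ℝ (Fin d)) := by
    apply Module.nontrivial_of_finrank_pos (R := ℝ)
    simp; omega
  rw [integrable_fun_norm_addHaar (volume : Measure (EuclideanSpace ℝ (Fin d)))
    (f := fun r => bose β (r ^ 2))]
  have h0 := (integrableOn_rpow_mul_exp_neg_mul_sq (b := β/2) (by positivity)
    (s := ((d - 3 : ℕ) : ℝ)) (by have : (0:ℝ) ≤ ((d - 3 : ℕ) : ℝ) := by positivity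
                                 linarith)).const_mul (1/β)
  refine Integrable.mono' h0 ?_ ?_
  · have := measurable_bose β
    exact Measurable.aestronglyMeasurable (by fun_prop)
  · refine (ae_restrict_iff' measurableSet_Ioi).2 (Eventually.of_forall ?_)
    intro r hr
    have hr : 0 < r := hr
    have hb := bose_le (β := β) (s := r ^ 2) (by positivity)
    have hn := bose_nonneg (β := β) (s := r ^ 2) hβ (by positivity)
    simp only [finrank_euclideanSpace, Fintype.card_fin, smul_eq_mul]
    rw [Real.norm_of_nonneg (by positivity), Real.rpow_natCast]
    obtain ⟨m, rfl⟩ : ∃ m, d = m + 3 := ⟨d - 3, by omega⟩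
    calc r ^ (m + 3 - 1) * bose β (r ^ 2)
        ≤ r ^ (m + 2) * (Real.exp (-(β * r ^ 2 / 2)) / (β * r ^ 2)) := by
          exact mul_le_mul_of_nonneg_left hb (by positivity)
      _ = _ := by
          have : -(β * r ^ 2 / 2) = -(β / 2) * r ^ 2 := by ring
          rw [this]
          simp only [Nat.add_sub_cancel]
          field_simp
          ring

lemma integrable_bose_pi (d : ℕ) (hd : 2 < d) (β : ℝ) (hβ : 0 < β) :
    Integrable (fun y : Fin d → ℝ => bose β (∑ i, y i ^ 2)) := by
  rw [← (PiLp.volume_preserving_ofLp (Fin d)).integrable_comp_emb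
    (MeasurableEquiv.toLp 2 (Fin d → ℝ)).symm.measurableEmbedding]
  have h := integrable_bose_norm d hd β hβ
  simp_rw [EuclideanSpace.real_norm_sq_eq] at h
  exact h

lemma integral_bose_pi (d : ℕ) (β : ℝ) :
    ∫ y : Fin d → ℝ, bose β (∑ i, y i ^ 2) = ∫ p : EuclideanSpace ℝ (Fin d), a1crit d β p := by
  rw [← (PiLp.volume_preserving_ofLp (Fin d)).integral_comp
    (MeasurableEquiv.toLp 2 (Fin d → ℝ)).symm.measurableEmbedding]
  congr 1
  ext p
  simp [EuclideanSpace.real_norm_sq_eq, a1crit, bose]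

/-- floor map -/
def cell (d : ℕ) (c : ℝ) (y : Fin d → ℝ) : Fin d → ℤ := fun i => ⌊y i / c⌋

lemma measurable_cell (d : ℕ) (c : ℝ) : Measurable (cell d c) := by
  unfold cell
  refine measurable_pi_lambda _ fun i => ?_
  exact Int.measurable_floor.comp (by fun_prop)

lemma map_cell (d : ℕ) (c : ℝ) (hc : 0 < c) :
    Measure.map (cell d c) volume = ENNReal.ofReal (c ^ d) • Measure.count := by
  refine Measure.ext_of_singleton fun k => ?_
  rw [Measure.map_apply (measurable_cell d c) (measurableSet_singleton k)]
  have : cell d c ⁻¹' {k} = Set.univ.pi fun i => Set.Ico (c * k i) (c * k i + c) := by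
    ext y
    simp only [Set.mem_preimage, Set.mem_singleton_iff, Set.mem_univ_pi, funext_iff, cell,
      Int.floor_eq_iff, Set.mem_Ico]
    refine forall_congr' fun i => ?_
    rw [le_div_iff₀ hc, div_lt_iff₀ hc]
    ring_nf
  rw [this, Real.volume_pi_Ico]
  simp [ENNReal.ofReal_pow hc.le]

lemma cell_bound (d : ℕ) (hd : 2 < d) (β : ℝ) (hβ : 0 < β) (c : ℝ) (hc : 0 < c)
    (y : Fin d → ℝ) :
    bose β (∑ i, (c * (cell d c y i : ℝ)) ^ 2) ≤ bose (β / (2 + 2 * d)) (∑ i, y i ^ 2) := by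
  have hβ' : 0 < β / (2 + 2 * (d:ℝ)) := by positivity
  by_cases hk : cell d c y = 0
  · simp only [hk]
    simp only [Pi.zero_apply, Int.cast_zero, mul_zero, ne_eq, OfNat.ofNat_ne_zero,
      not_false_eq_true, zero_pow, Finset.sum_const_zero, bose_zero]
    exact bose_nonneg hβ' (Finset.sum_nonneg fun i _ => sq_nonneg _)
  have hy : y ≠ 0 := by
    rintro rfl
    apply hk
    ext i; simp [cell]
  have hypos : 0 < ∑ i, y i ^ 2 := by
    obtain ⟨i, hi⟩ := Function.ne_iff.1 hy
    have hi : y i ≠ 0 := hi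
    exact Finset.sum_pos' (fun i _ => sq_nonneg _) ⟨i, Finset.mem_univ _, by positivity⟩
  apply bose_mono (by positivity)
  have h1 : 1 ≤ ∑ i, (cell d c y i : ℝ) ^ 2 := by
    obtain ⟨i, hi⟩ := Function.ne_iff.1 hk
    have hi : cell d c y i ≠ 0 := hi
    have : (1:ℝ) ≤ (cell d c y i : ℝ) ^ 2 := by
      exact_mod_cast Int.add_one_le_of_lt (by positivity : 0 < (cell d c y i) ^ 2)
    exact this.trans (Finset.single_le_sum (f := fun i => (cell d c y i : ℝ) ^ 2)
      (fun i _ => sq_nonneg _) (Finset.mem_univ i))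
  have h2 : ∀ i, y i ^ 2 ≤ c ^ 2 * (2 * (cell d c y i : ℝ) ^ 2 + 2) := by
    intro i
    have ha := Int.floor_le (y i / c)
    have hb := Int.lt_floor_add_one (y i / c)
    have : (y i / c) ^ 2 ≤ 2 * (cell d c y i : ℝ) ^ 2 + 2 := by
      simp only [cell]
      set f : ℝ := (⌊y i / c⌋ : ℝ)
      nlinarith [sq_nonneg (f - (y i / c - f)), sq_nonneg (f-1)]
    calc y i ^ 2 = c ^ 2 * (y i / c) ^ 2 := by field_simp
      _ ≤ _ := by gcongr
  have h3 : ∑ i, y i ^ 2 ≤ (2 + 2 * d) * ∑ i, (c * (cell d c y i : ℝ)) ^ 2 := by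
    calc ∑ i, y i ^ 2 ≤ ∑ i, c ^ 2 * (2 * (cell d c y i : ℝ) ^ 2 + 2) :=
          Finset.sum_le_sum fun i _ => h2 i
      _ = c ^ 2 * (2 * ∑ i, (cell d c y i : ℝ) ^ 2 + 2 * d * 1) := by
          rw [← Finset.mul_sum, Finset.sum_add_distrib, ← Finset.mul_sum]
          simp; left; ring
      _ ≤ c ^ 2 * (2 * ∑ i, (cell d c y i : ℝ) ^ 2 + 2 * d * ∑ i, (cell d c y i : ℝ) ^ 2) := by
          gcongr
      _ = _ := by
          simp only [mul_pow]
          rw [← Finset.mul_sum]; ring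
  rw [div_mul_eq_mul_div, div_le_iff₀ (by positivity)]
  calc β * ∑ i, y i ^ 2 ≤ β * ((2 + 2 * d) * ∑ i, (c * (cell d c y i : ℝ)) ^ 2) := by gcongr
    _ = _ := by ring

lemma integrable_cell (d : ℕ) (hd : 2 < d) (β : ℝ) (hβ : 0 < β) (c : ℝ) (hc : 0 < c) :
    Integrable (fun y : Fin d → ℝ => bose β (∑ i, (c * (cell d c y i : ℝ)) ^ 2)) := by
  refine Integrable.mono' (integrable_bose_pi d hd (β / (2 + 2 * d)) (by positivity)) ?_ ?_
  · exact ((measurable_of_countable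
      (fun k : Fin d → ℤ => bose β (∑ i, (c * (k i : ℝ)) ^ 2))).comp
      (measurable_cell d c)).aestronglyMeasurable
  · refine Eventually.of_forall fun y => ?_
    rw [Real.norm_of_nonneg (bose_nonneg hβ (Finset.sum_nonneg fun i _ => sq_nonneg _))]
    exact cell_bound d hd β hβ c hc y

lemma summable_and_integral (d : ℕ) (hd : 2 < d) (β : ℝ) (hβ : 0 < β) (c : ℝ) (hc : 0 < c) :
    Summable (fun k : Fin d → ℤ => bose β (∑ i, (c * (k i : ℝ)) ^ 2)) ∧
    ∫ y : Fin d → ℝ, bose β (∑ i, (c * (cell d c y i : ℝ)) ^ 2) =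
      c ^ d * ∑' k : Fin d → ℤ, bose β (∑ i, (c * (k i : ℝ)) ^ 2) := by
  have hm : Measurable (fun k : Fin d → ℤ => bose β (∑ i, (c * (k i : ℝ)) ^ 2)) :=
    measurable_of_countable _
  have h1 : Integrable (fun k : Fin d → ℤ => bose β (∑ i, (c * (k i : ℝ)) ^ 2))
      (Measure.map (cell d c) volume) := by
    rw [integrable_map_measure hm.aestronglyMeasurable (measurable_cell d c).aemeasurable]
    exact integrable_cell d hd β hβ c hc
  have h2 := integral_map (measurable_cell d c).aemeasurable
    (μ := volume) hm.aestronglyMeasurable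
  rw [← h2]
  rw [map_cell d c hc] at h1 ⊢
  rw [integrable_smul_measure (by simp; positivity) (by simp)] at h1
  constructor
  · have := integrable_count_iff.1 h1
    exact summable_norm_iff.1 this
  · rw [integral_smul_measure, integral_countable h1]
    simp [ENNReal.toReal_ofReal (pow_nonneg hc.le d), Measure.real]

lemma tendsto_cell (c : ℕ → ℝ) (hc : ∀ n, 0 < c n) (hc0 : Tendsto c atTop (nhds 0)) (y : ℝ) :
    Tendsto (fun n => c n * (⌊y / c n⌋ : ℝ)) atTop (nhds y) := by
  have h1 : Tendsto (fun n => y - c n) atTop (nhds y) := by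
    simpa using tendsto_const_nhds.sub hc0
  refine tendsto_of_tendsto_of_tendsto_of_le_of_le h1 tendsto_const_nhds ?_ ?_
  · intro n
    have := (Int.lt_floor_add_one (y / c n)).le
    rw [div_le_iff₀ (hc n)] at this
    simp only; linarith
  · intro n
    have := Int.floor_le (y / c n)
    rw [le_div_iff₀ (hc n)] at this
    simp only; linarith

lemma tendsto_riemann (d : ℕ) (hd : 2 < d) (β : ℝ) (hβ : 0 < β)
    (c : ℕ → ℝ) (hc : ∀ n, 0 < c n) (hc0 : Tendsto c atTop (nhds 0)) :
    Tendsto (fun n => c n ^ d * ∑' k : Fin d → ℤ, bose β (∑ i, (c n * (k i : ℝ)) ^ 2)) atTop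
      (nhds (∫ p : EuclideanSpace ℝ (Fin d), a1crit d β p)) := by
  have : Nonempty (Fin d) := ⟨⟨0, by omega⟩⟩
  rw [← integral_bose_pi]
  simp_rw [← fun n => (summable_and_integral d hd β hβ (c n) (hc n)).2]
  refine tendsto_integral_of_dominated_convergence
    (fun y : Fin d → ℝ => bose (β / (2 + 2 * d)) (∑ i, y i ^ 2))
    (fun n => (integrable_cell d hd β hβ (c n) (hc n)).aestronglyMeasurable)
    (integrable_bose_pi d hd _ (by positivity)) ?_ ?_
  · refine fun n => Eventually.of_forall fun y => ?_
    rw [Real.norm_of_nonneg (bose_nonneg hβ (Finset.sum_nonneg fun i _ => sq_nonneg _))]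
    exact cell_bound d hd β hβ (c n) (hc n) y
  · have : ∀ᵐ y : Fin d → ℝ, y ≠ 0 := by
      simp [ae_iff]
    filter_upwards [this] with y hy
    have hypos : 0 < ∑ i, y i ^ 2 := by
      obtain ⟨i, hi⟩ := Function.ne_iff.1 hy
      have hi : y i ≠ 0 := hi
      exact Finset.sum_pos' (fun i _ => sq_nonneg _) ⟨i, Finset.mem_univ _, by positivity⟩
    refine (bose_continuousAt (β := β) (by positivity)).tendsto.comp ?_
    refine tendsto_finsetSum _ fun i _ => ?_
    exact (tendsto_cell c hc hc0 (y i)).pow 2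

lemma gk_eq (d : ℕ) (β L : ℝ) (k : Fin d → ℤ) :
    gk d β L k = Real.exp (-β * ∑ i, (2 * Real.pi / L * (k i : ℝ)) ^ 2) := by
  unfold gk
  congr 2
  refine Finset.sum_congr rfl fun i _ => ?_
  ring

/-- main scalar inequality -/
lemma log_ineq {x : ℝ} (h1 : x < 1) :
    0 ≤ -Real.log (1 - x) - x ∧ -Real.log (1 - x) - x ≤ x ^ 2 / (1 - x) := by
  have hx : 0 < 1 - x := by linarith
  constructor
  · have := Real.log_le_sub_one_of_pos hx
    linarith
  · have := Real.log_le_sub_one_of_pos (inv_pos.2 hx)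
    rw [Real.log_inv] at this
    have h2 : x ^ 2 / (1 - x) = (1 - x)⁻¹ - 1 - x := by field_simp; ring
    linarith

lemma gk_pos (d : ℕ) (β L : ℝ) (k : Fin d → ℤ) : 0 < gk d β L k := Real.exp_pos _

lemma gk_zero (d : ℕ) (β L : ℝ) : gk d β L 0 = 1 := by simp [gk]

lemma sum_ge (d : ℕ) (c : ℝ) (k : Fin d → ℤ) (hk : k ≠ 0) :
    c ^ 2 ≤ ∑ i, (c * (k i : ℝ)) ^ 2 := by
  obtain ⟨i, hi⟩ := Function.ne_iff.1 hk
  have hi : k i ≠ 0 := hi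
  have : (1:ℝ) ≤ (k i : ℝ) ^ 2 := by
    exact_mod_cast Int.add_one_le_of_lt (by positivity : 0 < (k i) ^ 2)
  calc c ^ 2 ≤ (c * (k i : ℝ)) ^ 2 := by rw [mul_pow]; nlinarith [sq_nonneg c]
    _ ≤ _ := Finset.single_le_sum (f := fun i => (c * (k i : ℝ)) ^ 2)
      (fun i _ => sq_nonneg _) (Finset.mem_univ i)

lemma gk_lt_one (d : ℕ) (β L : ℝ) (hβ : 0 < β) (hL : 0 < L) (k : Fin d → ℤ) (hk : k ≠ 0) :
    gk d β L k < 1 := by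
  rw [gk_eq, Real.exp_lt_one_iff]
  have h1 : 0 < (2 * Real.pi / L) ^ 2 := by have := Real.pi_pos; positivity
  have h2 := h1.trans_le (sum_ge d (2 * Real.pi / L) k hk)
  nlinarith

lemma fixed_L (d : ℕ) (hd : 2 < d) (β : ℝ) (hβ : 0 < β) (L : ℝ) (hL : 0 < L) (z : ℝ)
    (hz0 : 0 < z) (hz1 : z < 1) (N : ℝ) (S : ℝ)
    (hS : S = ∑' k : Fin d → ℤ, bose β (∑ i, (2 * Real.pi / L * (k i : ℝ)) ^ 2))
    (hN : (∑' k : Fin d → ℤ, z * gk d β L k / (1 - z * gk d β L k)) = N) :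
    (Multipliable (fun k : {k : Fin d → ℤ // k ≠ 0} => 1 - z * gk d β L k.1) ∧
      Multipliable (fun k : {k : Fin d → ℤ // k ≠ 0} => 1 - gk d β L k.1)) ∧
    N ≤ z / (1 - z) + S ∧
    ∃ T : ℝ, 0 ≤ T ∧ T ≤ (1 - z) ^ 2 * (1 / (β * (2 * Real.pi / L) ^ 2)) * S ∧
      (∏' k : {k : Fin d → ℤ // k ≠ 0}, (1 - z * gk d β L k.1) / (1 - gk d β L k.1)) *
          Real.exp (-((1 - z) / z) * (N - z / (1 - z))) = Real.exp T := by
  have hpi := Real.pi_pos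
  set c := 2 * Real.pi / L with hc
  have hcpos : 0 < c := by positivity
  have hsum := (summable_and_integral d hd β hβ c hcpos).1
  have hb : ∀ k : Fin d → ℤ, bose β (∑ i, (c * (k i : ℝ)) ^ 2)
      = gk d β L k / (1 - gk d β L k) := by
    intro k; rw [gk_eq]; rfl
  have hbn : ∀ k : Fin d → ℤ, 0 ≤ gk d β L k / (1 - gk d β L k) := by
    intro k; rw [← hb]; exact bose_nonneg hβ (Finset.sum_nonneg fun i _ => sq_nonneg _)
  simp_rw [hb] at hsum hS
  have hg0 := gk_pos d β L
  have hg1 : ∀ k : {k : Fin d → ℤ // k ≠ 0}, gk d β L k.1 < 1 :=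
    fun k => gk_lt_one d β L hβ hL k.1 k.2
  have hzg : ∀ k : {k : Fin d → ℤ // k ≠ 0}, z * gk d β L k.1 < gk d β L k.1 := by
    intro k; nlinarith [hg0 k.1]
  have hsumK : Summable (fun k : {k : Fin d → ℤ // k ≠ 0} =>
      gk d β L k.1 / (1 - gk d β L k.1)) := hsum.subtype {k | k ≠ 0}
  have hSK : ∑' k : {k : Fin d → ℤ // k ≠ 0}, gk d β L k.1 / (1 - gk d β L k.1) ≤ S := by
    rw [hS]; exact hsum.tsum_subtype_le _ {k | k ≠ 0} hbn
  have hgK : Summable (fun k : {k : Fin d → ℤ // k ≠ 0} => gk d β L k.1) := by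
    refine Summable.of_nonneg_of_le (fun k => (hg0 k.1).le) (fun k => ?_) hsumK
    rw [le_div_iff₀ (by linarith [hg1 k])]
    nlinarith [hg0 k.1]
  -- the weights
  have hle : ∀ k : {k : Fin d → ℤ // k ≠ 0}, gk d β L k.1 / (1 - z * gk d β L k.1)
      ≤ gk d β L k.1 / (1 - gk d β L k.1) := by
    intro k
    have h1 := hg1 k
    have h2 := hzg k
    exact div_le_div_of_nonneg_left (hg0 k.1).le (by linarith) (by linarith)
  have hwK : Summable (fun k : {k : Fin d → ℤ // k ≠ 0} =>
      gk d β L k.1 / (1 - z * gk d β L k.1)) := by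
    refine Summable.of_nonneg_of_le (fun k => ?_) hle hsumK
    have h1 := hg1 k
    have h2 := hzg k
    exact div_nonneg (hg0 k.1).le (by linarith)
  set W := ∑' k : {k : Fin d → ℤ // k ≠ 0}, gk d β L k.1 / (1 - z * gk d β L k.1) with hW
  have hWS : W ≤ S := (hwK.tsum_le_tsum hle hsumK).trans hSK
  have hNW : N = z / (1 - z) + z * W := by
    have hK2 : Summable ((fun k : Fin d → ℤ => z * gk d β L k / (1 - z * gk d β L k)) ∘
        (fun k : (({0} : Set (Fin d → ℤ))ᶜ : Set (Fin d → ℤ)) => (k : Fin d → ℤ))) := by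
      refine (hwK.mul_left z).congr fun k => ?_
      exact (mul_div_assoc z _ _).symm
    have hfull : Summable (fun k : Fin d → ℤ => z * gk d β L k / (1 - z * gk d β L k)) :=
      (Set.finite_singleton (0 : Fin d → ℤ)).summable_compl_iff.1 hK2
    rw [← hN, ← hfull.tsum_subtype_add_tsum_subtype_compl {0}, hW, ← tsum_mul_left]
    congr 1
    · rw [tsum_singleton (0 : Fin d → ℤ)
        (fun k : Fin d → ℤ => z * gk d β L k / (1 - z * gk d β L k))]
      simp [gk_zero]
    · refine tsum_congr fun k => ?_
      rw [mul_div_assoc]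
  have hWn : 0 ≤ W := tsum_nonneg fun k => div_nonneg (hg0 k.1).le
    (by linarith [hg1 k, hzg k])
  refine ⟨⟨?_, ?_⟩, ?_, ?_⟩
  · have := multipliable_one_add_of_summable (R := ℝ)
      (f := fun k : {k : Fin d → ℤ // k ≠ 0} => -(z * gk d β L k.1))
      (hgK.mul_left z).neg.norm
    simpa [sub_eq_add_neg] using this
  · have := multipliable_one_add_of_summable (R := ℝ)
      (f := fun k : {k : Fin d → ℤ // k ≠ 0} => -(gk d β L k.1))
      hgK.neg.norm
    simpa [sub_eq_add_neg] using this
  · rw [hNW]; nlinarith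
  · let x : {k : Fin d → ℤ // k ≠ 0} → ℝ :=
      fun k => (1 - z) * (gk d β L k.1 / (1 - z * gk d β L k.1))
    have hx : ∀ k, 1 - x k = (1 - gk d β L k.1) / (1 - z * gk d β L k.1) := by
      intro k
      have : 1 - z * gk d β L k.1 ≠ 0 := by linarith [hg1 k, hzg k]
      simp only [x]; field_simp; ring
    have hx1 : ∀ k, x k < 1 := by
      intro k
      have : 0 < 1 - x k := by
        rw [hx]
        exact div_pos (by linarith [hg1 k]) (by linarith [hg1 k, hzg k])
      linarith
    have hxs : Summable x := hwK.mul_left _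
    have hxsum : ∑' k, x k = (1 - z) * W := tsum_mul_left
    let t : {k : Fin d → ℤ // k ≠ 0} → ℝ := fun k => -Real.log (1 - x k) - x k
    have ht0 : ∀ k, 0 ≤ t k := fun k => (log_ineq (hx1 k)).1
    have ht1 : ∀ k, t k ≤ (1 - z) ^ 2 * (1 / (β * c ^ 2)) *
        (gk d β L k.1 / (1 - gk d β L k.1)) := by
      intro k
      refine (log_ineq (hx1 k)).2.trans ?_
      have hbk : gk d β L k.1 / (1 - gk d β L k.1) ≤ 1 / (β * c ^ 2) := by
        rw [← hb]
        have h1 := sum_ge d c k.1 k.2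
        have h2 : 0 < c ^ 2 := by positivity
        refine (bose_le_inv (mul_pos hβ (h2.trans_le h1))).trans ?_
        gcongr
      have e1 : 0 < 1 - gk d β L k.1 := by linarith [hg1 k]
      have e2 : 0 < 1 - z * gk d β L k.1 := by linarith [hg1 k, hzg k]
      have e : x k ^ 2 / (1 - x k) = (1 - z) ^ 2 * (gk d β L k.1 / (1 - z * gk d β L k.1)) *
          (gk d β L k.1 / (1 - gk d β L k.1)) := by
        rw [hx]; simp only [x]; field_simp
      rw [e]
      have := hbn k.1
      have := (hle k).trans hbk
      gcongr
    have hts : Summable t := Summable.of_nonneg_of_le ht0 ht1 (hsumK.mul_left _)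
    refine ⟨∑' k, t k, tsum_nonneg ht0, ?_, ?_⟩
    · refine (hts.tsum_le_tsum ht1 (hsumK.mul_left _)).trans ?_
      rw [tsum_mul_left]
      gcongr
    · have hlog : ∀ k : {k : Fin d → ℤ // k ≠ 0},
          Real.log ((1 - z * gk d β L k.1) / (1 - gk d β L k.1)) = t k + x k := by
        intro k
        simp only [t]
        rw [hx, ← Real.log_inv, inv_div]; ring
      have hls : Summable (fun k : {k : Fin d → ℤ // k ≠ 0} =>
          Real.log ((1 - z * gk d β L k.1) / (1 - gk d β L k.1))) := by
        simp_rw [hlog]; exact hts.add hxs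
      rw [← Real.rexp_tsum_eq_tprod (fun k => div_pos (by linarith [hg1 k, hzg k])
        (by linarith [hg1 k])) hls, ← Real.exp_add]
      congr 1
      simp_rw [hlog]
      rw [hts.tsum_add hxs, hxsum, hNW]
      field_simp
      ring

/-- Lemma 8(i): in the supercritical thermodynamic limit, with `z₀ = z₀(L_n,N_n)`
and `p₀ = z₀/(1-z₀)`,
`Det[1-z₀Q₀G_LQ₀]/Det[1-Q₀G_LQ₀] · exp(-((1-z₀)/z₀)(N-p₀)) → 1`,
where the determinant ratio is `Π_{k≠0} (1-z₀g_k)/(1-g_k)`;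
both infinite products converge. -/
theorem det_ratio_limit (d : ℕ) (hd : 2 < d) (β : ℝ) (hβ : 0 < β)
    (L : ℕ → ℝ) (hLpos : ∀ n, 0 < L n) (hL : Tendsto L atTop atTop)
    (N : ℕ → ℕ) (hN : ∀ n, 1 ≤ N n) (ρ : ℝ)
    (hρsup : (∫ p : EuclideanSpace ℝ (Fin d), a1crit d β p) / (2 * Real.pi) ^ d < ρ)
    (hdens : Tendsto (fun n => (N n : ℝ) / L n ^ d) atTop (nhds ρ))
    (z : ℕ → ℝ)
    (hz : ∀ n, z n ∈ Set.Ioo (0 : ℝ) 1 ∧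
      (∑' k : Fin d → ℤ, z n * gk d β (L n) k / (1 - z n * gk d β (L n) k)) = N n) :
    (∀ n, Multipliable (fun k : {k : Fin d → ℤ // k ≠ 0} => 1 - z n * gk d β (L n) k.1) ∧
          Multipliable (fun k : {k : Fin d → ℤ // k ≠ 0} => 1 - gk d β (L n) k.1)) ∧
    Tendsto
      (fun n =>
        (∏' k : {k : Fin d → ℤ // k ≠ 0},
            (1 - z n * gk d β (L n) k.1) / (1 - gk d β (L n) k.1)) *
          Real.exp (-((1 - z n) / z n) * ((N n : ℝ) - z n / (1 - z n))))
      atTop (nhds 1) := by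
  have hpi := Real.pi_pos
  have hfix := fun n => fixed_L d hd β hβ (L n) (hLpos n) (z n) (hz n).1.1 (hz n).1.2 (N n) _ rfl
    (hz n).2
  refine ⟨fun n => (hfix n).1, ?_⟩
  set S : ℕ → ℝ := fun n =>
    ∑' k : Fin d → ℤ, bose β (∑ i, (2 * Real.pi / L n * (k i : ℝ)) ^ 2) with hSdef
  choose T hT0 hT1 hT using fun n => (hfix n).2.2
  simp_rw [hT]
  have hNS : ∀ n, (N n : ℝ) ≤ z n / (1 - z n) + S n := fun n => (hfix n).2.1
  set R := (∫ p : EuclideanSpace ℝ (Fin d), a1crit d β p) / (2 * Real.pi) ^ d with hR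
  have hS : Tendsto (fun n => S n / L n ^ d) atTop (nhds R) := by
    have hc0 : Tendsto (fun n => 2 * Real.pi / L n) atTop (nhds 0) :=
      tendsto_const_nhds.div_atTop hL
    have := (tendsto_riemann d hd β hβ (fun n => 2 * Real.pi / L n)
      (fun n => div_pos (by positivity) (hLpos n)) hc0).div_const ((2 * Real.pi) ^ d)
    refine this.congr fun n => ?_
    have := (hLpos n).ne'
    simp only [hSdef, div_pow]
    field_simp
  have hdiff : Tendsto (fun n => (N n : ℝ) / L n ^ d - S n / L n ^ d) atTop (nhds (ρ - R)) :=
    hdens.sub hS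
  have hev : ∀ᶠ n in atTop, (ρ - R) / 2 < (N n : ℝ) / L n ^ d - S n / L n ^ d :=
    hdiff.eventually_const_lt (by linarith)
  have hδ : 0 < (ρ - R) / 2 := by linarith
  set δ := (ρ - R) / 2
  have hTlim : Tendsto T atTop (nhds 0) := by
    have hlim : Tendsto (fun n => 1 / (δ ^ 2 * (β * (2 * Real.pi) ^ 2)) * (S n / L n ^ d) *
        (1 / L n ^ (d - 2))) atTop (nhds 0) := by
      have h1 : Tendsto (fun n => 1 / L n ^ (d - 2)) atTop (nhds 0) :=
        tendsto_const_nhds.div_atTop ((tendsto_pow_atTop (by omega)).comp hL)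
      have h2 := (hS.const_mul (1 / (δ ^ 2 * (β * (2 * Real.pi) ^ 2)))).mul h1
      rwa [mul_zero] at h2
    refine tendsto_of_tendsto_of_tendsto_of_le_of_le' tendsto_const_nhds hlim
      (Eventually.of_forall hT0) ?_
    filter_upwards [hev] with n hn
    refine (hT1 n).trans ?_
    have hLn := hLpos n
    obtain ⟨⟨hz0, hz1⟩, -⟩ := hz n
    have hSn : 0 ≤ S n :=
      tsum_nonneg fun k => bose_nonneg hβ (Finset.sum_nonneg fun i _ => sq_nonneg _)
    have hLd : 0 < L n ^ d := by positivity
    have hε : 1 - z n ≤ 1 / (δ * L n ^ d) := by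
      have h1 : δ * L n ^ d ≤ z n / (1 - z n) := by
        rw [← sub_div, lt_div_iff₀ hLd] at hn
        linarith [hNS n]
      rw [le_div_iff₀ (by linarith)] at h1
      rw [le_div_iff₀ (by positivity)]
      linarith
    calc (1 - z n) ^ 2 * (1 / (β * (2 * Real.pi / L n) ^ 2)) * S n
        ≤ (1 / (δ * L n ^ d)) ^ 2 * (1 / (β * (2 * Real.pi / L n) ^ 2)) * S n := by
          have : 0 ≤ 1 - z n := by linarith
          gcongr
      _ = _ := by
          obtain ⟨m, rfl⟩ : ∃ m, d = m + 2 := ⟨d - 2, by omega⟩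
          simp only [Nat.add_sub_cancel]
          field_simp
          ring
  have hfin := (Real.continuous_exp.tendsto 0).comp hTlim
  rw [Real.exp_zero] at hfin
  exact hfin
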